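/- arXiv:math/9806082 — 2 statements merged into one kernel-verified Lean document; each statement's English description precedes it below -/
import Mathlib

section
/- Let $U_1, U_2 \subseteq \mathbb{C}$ be nonempty connected open sets, let $\varphi_1 : U_1 \to \mathbb{C}$ and $\varphi_2 : U_2 \to \mathbb{C}$ be holomorphic, and let $\tau : U_1 \times U_2 \to \mathbb{C}$ be holomorphic. Suppose that for all $(z_1, z_2) \in U_1 \times U_2$ and for $i = 1, 2$ the following identities hold (where $\varphi_1, \varphi_1', \varphi_1''$ are evaluated at $z_1$ and $\varphi_2, \varphi_2', \varphi_2''$ at $z_2$): $\frac{\partial}{\partial z_i}\big(\varphi_1 \varphi_2\big) = \frac{\partial \tau}{\partial z_i}\big(\varphi_1' \varphi_2^2 + \varphi_1^2 \varphi_2'\big)$ and $\frac{\partial}{\partial z_i}\big(\varphi_1' \varphi_2^2 + \varphi_1^2 \varphi_2'\big) = \frac{\partial \tau}{\partial z_i}\big(\varphi_1'' \varphi_2^3 + 5\,\varphi_1 \varphi_2 \varphi_1' \varphi_2' + \varphi_1^3 \varphi_2''\big)$. Then $\varphi_1'$ vanishes identically on $U_1$ or $\varphi_2'$ vanishes identically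 on $U_2$. -/
open Filter Topology in
/-- A holomorphic function `f` with `f * f' = 0` on an open set has `f' = 0` there. -/
theorem deriv_eq_zero_of_mul_deriv_eq_zero {U : Set ℂ} (hU : IsOpen U) {f : ℂ → ℂ}
    (hf : DifferentiableOn ℂ f U) (h : ∀ z ∈ U, f z * deriv f z = 0) :
    ∀ z ∈ U, deriv f z = 0 := by
  intro z hz
  by_contra hne
  have hzU : U ∈ 𝓝 z := hU.mem_nhds hz
  have hev : ∀ᶠ w in 𝓝 z, deriv f w ≠ 0 :=
    ((hf.deriv hU).continuousOn.continuousAt hzU).eventually_ne hne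
  have hzero : f =ᶠ[𝓝 z] fun _ => 0 := by
    filter_upwards [hev, hzU] with w hw hwU
    exact (mul_eq_zero.mp (h w hwU)).resolve_right hw
  exact hne (by rw [hzero.deriv_eq, deriv_const])

/-- If the zeroth and first Taylor coefficients of the tensor product germ of
two one-dimensional Frobenius manifolds are independent of the base point
(expressed by the displayed differential identities), then one of the two
third derivatives of the potentials has vanishing derivative, i.e. one factor
has locally constant multiplication. -/
theorem one_dim_tensor_connection_forces_constant_multiplication
    (U₁ U₂ : Set ℂ) (hU₁o : IsOpen U₁) (hU₂o : IsOpen U₂)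
    (hU₁c : IsConnected U₁) (hU₂c : IsConnected U₂)
    (φ₁ φ₂ : ℂ → ℂ) (τ : ℂ × ℂ → ℂ)
    (hφ₁ : DifferentiableOn ℂ φ₁ U₁) (hφ₂ : DifferentiableOn ℂ φ₂ U₂)
    (hτ : DifferentiableOn ℂ τ (U₁ ×ˢ U₂))
    (h₁₁ : ∀ z₁ ∈ U₁, ∀ z₂ ∈ U₂,
      deriv (fun w => φ₁ w * φ₂ z₂) z₁
        = deriv (fun w => τ (w, z₂)) z₁ *
            (deriv φ₁ z₁ * (φ₂ z₂) ^ 2 + (φ₁ z₁) ^ 2 * deriv φ₂ z₂))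
    (h₁₂ : ∀ z₁ ∈ U₁, ∀ z₂ ∈ U₂,
      deriv (fun w => φ₁ z₁ * φ₂ w) z₂
        = deriv (fun w => τ (z₁, w)) z₂ *
            (deriv φ₁ z₁ * (φ₂ z₂) ^ 2 + (φ₁ z₁) ^ 2 * deriv φ₂ z₂))
    (h₂₁ : ∀ z₁ ∈ U₁, ∀ z₂ ∈ U₂,
      deriv (fun w => deriv φ₁ w * (φ₂ z₂) ^ 2 + (φ₁ w) ^ 2 * deriv φ₂ z₂) z₁
        = deriv (fun w => τ (w, z₂)) z₁ *
            (deriv (deriv φ₁) z₁ * (φ₂ z₂) ^ 3 +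
              5 * φ₁ z₁ * φ₂ z₂ * deriv φ₁ z₁ * deriv φ₂ z₂ +
              (φ₁ z₁) ^ 3 * deriv (deriv φ₂) z₂))
    (h₂₂ : ∀ z₁ ∈ U₁, ∀ z₂ ∈ U₂,
      deriv (fun w => deriv φ₁ z₁ * (φ₂ w) ^ 2 + (φ₁ z₁) ^ 2 * deriv φ₂ w) z₂
        = deriv (fun w => τ (z₁, w)) z₂ *
            (deriv (deriv φ₁) z₁ * (φ₂ z₂) ^ 3 +
              5 * φ₁ z₁ * φ₂ z₂ * deriv φ₁ z₁ * deriv φ₂ z₂ +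
              (φ₁ z₁) ^ 3 * deriv (deriv φ₂) z₂)) :
    (∀ z ∈ U₁, deriv φ₁ z = 0) ∨ (∀ z ∈ U₂, deriv φ₂ z = 0) := by
  have d₁ : ∀ z ∈ U₁, DifferentiableAt ℂ φ₁ z := fun z hz =>
    hφ₁.differentiableAt (hU₁o.mem_nhds hz)
  have d₂ : ∀ z ∈ U₂, DifferentiableAt ℂ φ₂ z := fun z hz =>
    hφ₂.differentiableAt (hU₂o.mem_nhds hz)
  have dd₁ : ∀ z ∈ U₁, DifferentiableAt ℂ (deriv φ₁) z := fun z hz =>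
    (hφ₁.deriv hU₁o).differentiableAt (hU₁o.mem_nhds hz)
  have dd₂ : ∀ z ∈ U₂, DifferentiableAt ℂ (deriv φ₂) z := fun z hz =>
    (hφ₂.deriv hU₂o).differentiableAt (hU₂o.mem_nhds hz)
  have key : ∀ z₁ ∈ U₁, ∀ z₂ ∈ U₂,
      φ₁ z₁ * deriv φ₁ z₁ = 0 ∨ φ₂ z₂ * deriv φ₂ z₂ = 0 := by
    intro z₁ hz₁ z₂ hz₂
    have e₁₁ := h₁₁ z₁ hz₁ z₂ hz₂
    have e₁₂ := h₁₂ z₁ hz₁ z₂ hz₂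
    have e₂₁ := h₂₁ z₁ hz₁ z₂ hz₂
    have e₂₂ := h₂₂ z₁ hz₁ z₂ hz₂
    rw [((d₁ z₁ hz₁).hasDerivAt.mul_const _).deriv] at e₁₁
    rw [((d₂ z₂ hz₂).hasDerivAt.const_mul _).deriv] at e₁₂
    rw [(((dd₁ z₁ hz₁).hasDerivAt.mul_const _).fun_add
      (((d₁ z₁ hz₁).hasDerivAt.fun_pow 2).mul_const _)).deriv] at e₂₁
    rw [((((d₂ z₂ hz₂).hasDerivAt.fun_pow 2).const_mul _).fun_add
      ((dd₂ z₂ hz₂).hasDerivAt.const_mul _)).deriv] at e₂₂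
    norm_num at e₂₁ e₂₂
    generalize deriv (fun w => τ (w, z₂)) z₁ = t₁ at *
    generalize deriv (fun w => τ (z₁, w)) z₂ = t₂ at *
    generalize deriv (deriv φ₁) z₁ = A at *
    generalize deriv (deriv φ₂) z₂ = B at *
    generalize deriv φ₁ z₁ = a at *
    generalize deriv φ₂ z₂ = b at *
    generalize φ₁ z₁ = f at *
    generalize φ₂ z₂ = g at *
    set S := a * g ^ 2 + f ^ 2 * b with hS
    set T := A * g ^ 3 + 5 * f * g * a * b + f ^ 3 * B with hT
    have c₁ : (A * g ^ 2 + 2 * f * a * b) * S = a * g * T := by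
      linear_combination S * e₂₁ - T * e₁₁
    have c₂ : (2 * a * g * b + f ^ 2 * B) * S = f * b * T := by
      linear_combination S * e₂₂ - T * e₁₂
    -- The Taylor coefficient `S` vanishes wherever `f * g * a * b` does not.
    have hfgS : f * g * a * b * S = 0 := by
      simp only [hS, hT] at c₁ c₂ ⊢
      linear_combination -g * c₁ - f * c₂
    have hprod : f * g ^ 2 * a ^ 2 * b = 0 := by
      linear_combination f * g * a * b * e₁₁ + t₁ * hfgS
    simp only [mul_eq_zero, pow_eq_zero_iff, ne_eq, OfNat.ofNat_ne_zero, not_false_eq_true]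
      at hprod ⊢
    tauto
  by_cases h : ∀ z ∈ U₁, φ₁ z * deriv φ₁ z = 0
  · exact Or.inl (deriv_eq_zero_of_mul_deriv_eq_zero hU₁o hφ₁ h)
  · push Not at h
    obtain ⟨z₁, hz₁, hne⟩ := h
    exact Or.inr (deriv_eq_zero_of_mul_deriv_eq_zero hU₂o hφ₂
      fun z₂ hz₂ => (key z₁ hz₁ z₂ hz₂).resolve_left hne)
end

section
/- Let $n_1, n_2 \ge 1$. For $i = 1, 2$ let $A^{(i)}, D^{U,i}, D^{V,i}$ be $n_i \times n_i$ complex matrices and $r^{U,i}, r^{V,i}, \xi^{(i)}, e^{(i)} \in \mathbb{C}^{n_i}$, and set $f^{(i)} := A^{(i)} e^{(i)}$. Assume for $i = 1, 2$: (a) $A^{(i)} D^{U,i} = D^{V,i} A^{(i)}$, (b) $A^{(i)} r^{U,i} = D^{V,i} \xi^{(i)} + r^{V,i}$, and (c) $D^{V,i} f^{(i)} = f^{(i)}$. Define affine maps of $\mathbb{C}^{n_1} \otimes \mathbb{C}^{n_2}$ by $E^U(x) := (D^{U,1} \otimes I + I \otimes D^{U,2} - I \otimes I)\,x + r^{U,1}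 \otimes e^{(2)} + e^{(1)} \otimes r^{U,2}$, $E^V(x) := (D^{V,1} \otimes I + I \otimes D^{V,2} - I \otimes I)\,x + r^{V,1} \otimes f^{(2)} + f^{(1)} \otimes r^{V,2}$, and $\bar\varphi(x) := (A^{(1)} \otimes A^{(2)})\,x + \xi^{(1)} \otimes f^{(2)} + f^{(1)} \otimes \xi^{(2)}$. Then $(A^{(1)} \otimes A^{(2)})\, E^U(x) = E^V(\bar\varphi(x))$ for all $x \in \mathbb{C}^{n_1} \otimes \mathbb{C}^{n_2}$. -/
open Matrix
open scoped Kronecker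

/-- The Kronecker (tensor) product of two vectors. -/
def vecKron {n₁ n₂ : ℕ} (v : Fin n₁ → ℂ) (w : Fin n₂ → ℂ) :
    Fin n₁ × Fin n₂ → ℂ :=
  fun p => v p.1 * w p.2

/-- The Kronecker product of matrices acts factorwise on tensor products of vectors. -/
lemma kronecker_mulVec_vecKron {n₁ n₂ : ℕ} (A : Matrix (Fin n₁) (Fin n₁) ℂ)
    (B : Matrix (Fin n₂) (Fin n₂) ℂ) (v : Fin n₁ → ℂ) (w : Fin n₂ → ℂ) :
    (A ⊗ₖ B) *ᵥ vecKron v w = vecKron (A *ᵥ v) (B *ᵥ w) := by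
  ext ⟨i, j⟩
  simp only [mulVec, dotProduct, vecKron, kroneckerMap_apply, Fintype.sum_prod_type,
    Finset.sum_mul_sum]
  exact Finset.sum_congr rfl fun _ _ => Finset.sum_congr rfl fun _ _ => by ring

lemma vecKron_add_left {n₁ n₂ : ℕ} (v v' : Fin n₁ → ℂ) (w : Fin n₂ → ℂ) :
    vecKron (v + v') w = vecKron v w + vecKron v' w := by
  ext p
  exact add_mul _ _ _

lemma vecKron_add_right {n₁ n₂ : ℕ} (v : Fin n₁ → ℂ) (w w' : Fin n₂ → ℂ) :
    vecKron v (w + w') = vecKron v w + vecKron v w' := by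
  ext p
  exact mul_add _ _ _

/-- The locally defined tensor product Euler fields glue under the induced
affine transition functions of the tensor product manifold. -/
theorem tensor_euler_fields_glue {n₁ n₂ : ℕ} (hn₁ : 1 ≤ n₁) (hn₂ : 1 ≤ n₂)
    (A₁ DU₁ DV₁ : Matrix (Fin n₁) (Fin n₁) ℂ)
    (A₂ DU₂ DV₂ : Matrix (Fin n₂) (Fin n₂) ℂ)
    (rU₁ rV₁ ξ₁ e₁ : Fin n₁ → ℂ) (rU₂ rV₂ ξ₂ e₂ : Fin n₂ → ℂ)
    (ha₁ : A₁ * DU₁ = DV₁ * A₁) (ha₂ : A₂ * DU₂ = DV₂ * A₂)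
    (hb₁ : A₁ *ᵥ rU₁ = DV₁ *ᵥ ξ₁ + rV₁) (hb₂ : A₂ *ᵥ rU₂ = DV₂ *ᵥ ξ₂ + rV₂)
    (hc₁ : DV₁ *ᵥ (A₁ *ᵥ e₁) = A₁ *ᵥ e₁) (hc₂ : DV₂ *ᵥ (A₂ *ᵥ e₂) = A₂ *ᵥ e₂) :
    ∀ x : Fin n₁ × Fin n₂ → ℂ,
      (A₁ ⊗ₖ A₂) *ᵥ
          ((DU₁ ⊗ₖ (1 : Matrix (Fin n₂) (Fin n₂) ℂ) +
              (1 : Matrix (Fin n₁) (Fin n₁) ℂ) ⊗ₖ DU₂ -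
              (1 : Matrix (Fin n₁) (Fin n₁) ℂ) ⊗ₖ (1 : Matrix (Fin n₂) (Fin n₂) ℂ)) *ᵥ x
            + vecKron rU₁ e₂ + vecKron e₁ rU₂)
        = (DV₁ ⊗ₖ (1 : Matrix (Fin n₂) (Fin n₂) ℂ) +
              (1 : Matrix (Fin n₁) (Fin n₁) ℂ) ⊗ₖ DV₂ -
              (1 : Matrix (Fin n₁) (Fin n₁) ℂ) ⊗ₖ (1 : Matrix (Fin n₂) (Fin n₂) ℂ)) *ᵥ
            ((A₁ ⊗ₖ A₂) *ᵥ x + vecKron ξ₁ (A₂ *ᵥ e₂) + vecKron (A₁ *ᵥ e₁) ξ₂)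
          + vecKron rV₁ (A₂ *ᵥ e₂) + vecKron (A₁ *ᵥ e₁) rV₂ := by
  intro x
  simp only [mulVec_add, add_mulVec, sub_mulVec, mulVec_sub, kronecker_mulVec_vecKron,
    add_mul, sub_mul, mulVec_mulVec, ← mul_kronecker_mul, one_mul, mul_one, one_mulVec] at hc₁ hc₂ ⊢
  rw [ha₁, ha₂]
  simp only [hb₁, hb₂, hc₁, hc₂, vecKron_add_left, vecKron_add_right]
  abel
end
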